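/- arXiv:2507.07501 — 2 statements merged into one kernel-verified Lean document; each statement's English description precedes it below -/
import Mathlib

section
/- If a profile P⁰_H of responsive hospital preferences satisfies aversion to couple diversity, then for every extension of P⁰_H — i.e., every preference profile P with responsive couple preferences and with P_h = P⁰_h for all hospitals h — there exists a stable matching. -/
/- A formal framework for many-to-one matching markets with couples
(hospitals/doctors), following the paper's definitions.  The dummy hospital
`λ` is modelled as `none : Option H`. -/

namespace CouplesMarket

open Finset

/-- A strict linear order on a subset `s` of `α`:  trichotomy on `s`,
irreflexivity, transitivity and asymmetry. -/
def StrictLinearOn {α : Type} (s : Set α) (r : α → α → Prop) : Prop :=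
  (∀ a ∈ s, ∀ b ∈ s, a = b ∨ r a b ∨ r b a) ∧
  (∀ a ∈ s, ¬ r a a) ∧
  (∀ a ∈ s, ∀ b ∈ s, ∀ c ∈ s, r a b → r b c → r a c) ∧
  (∀ a ∈ s, ∀ b ∈ s, r a b → ¬ r b a)

/-- A strict linear order on all of `α`. -/
def StrictLinear {α : Type} (r : α → α → Prop) : Prop :=
  StrictLinearOn Set.univ r

/-- The weak (reflexive) part `R` of a strict preference `P`. -/
def weakPref {α : Type} (r : α → α → Prop) (a b : α) : Prop := a = b ∨ r a b

/-- A matching market: hospitals `H` with capacities `κ`, doctors `D`, and a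
set of (pairwise disjoint) couples `c = (f, m)` (first component in `F`,
second in `M`; the remaining doctors are single). -/
structure Market (D H : Type) where
  κ : H → ℕ
  couples : Finset (D × D)
  couples_ne : ∀ c ∈ couples, c.1 ≠ c.2
  couples_disjoint : ∀ c ∈ couples, ∀ c' ∈ couples, c ≠ c' →
    c.1 ≠ c'.1 ∧ c.1 ≠ c'.2 ∧ c.2 ≠ c'.1 ∧ c.2 ≠ c'.2

/-- A doctor is single if he/she belongs to no couple. -/
def Market.Single {D H : Type} (M : Market D H) (d : D) : Prop :=
  ∀ c ∈ M.couples, d ≠ c.1 ∧ d ≠ c.2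

/-- A preference profile: for each hospital `h` its set `acc h = D_h` of
acceptable doctors, its linear order `rank h = P̄_h` over individual doctors,
and its preference `hpref h = P_h` over feasible sets of doctors; for each
doctor `d` an individual (resp. marginal, for couple members) preference
`dpref d = P_d` over `H ∪ {λ}`; and for each couple `c` a preference
`cpref c = P_c` over pairs in `(H ∪ {λ})²`. -/
structure Profile (D H : Type) where
  acc : H → Finset D
  rank : H → D → D → Prop
  hpref : H → Finset D → Finset D → Prop
  dpref : D → Option H → Option H → Prop
  cpref : D × D → Option H × Option H → Option H × Option H → Prop

variable {D H : Type} [Fintype D] [DecidableEq D] [Fintype H] [DecidableEq H]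

/-- Responsiveness of hospital `h`'s preference over feasible sets of doctors:
`rank h` is a linear order on `acc h`; `hpref h` is a linear order on feasible
sets; every nonempty feasible subset of acceptable doctors is preferred to `∅`;
singleton comparisons agree with `rank h`; adding a common acceptable doctor to
two feasible subsets of acceptable doctors preserves their comparison; and `∅`
is preferred to every feasible set not contained in `acc h`. -/
def HospResponsive (M : Market D H) (P : Profile D H) (h : H) : Prop :=
  StrictLinearOn {d | d ∈ P.acc h} (P.rank h) ∧
  StrictLinearOn {A : Finset D | A.card ≤ M.κ h} (P.hpref h) ∧
  (∀ A : Finset D, A ⊆ P.acc h → A.Nonempty → A.card ≤ M.κ h → P.hpref h A ∅) ∧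
  (∀ d ∈ P.acc h, ∀ d' ∈ P.acc h, d ≠ d' → (P.hpref h {d} {d'} ↔ P.rank h d d')) ∧
  (∀ A B : Finset D, A ⊆ P.acc h → B ⊆ P.acc h → A.card < M.κ h → B.card < M.κ h →
      ∀ d ∈ P.acc h, d ∉ A → d ∉ B →
        (P.hpref h (insert d A) (insert d B) ↔ P.hpref h A B)) ∧
  (∀ A : Finset D, A.card ≤ M.κ h → ¬ A ⊆ P.acc h → P.hpref h ∅ A)

/-- Responsiveness of a couple's preference over pairs of hospitals with
respect to the induced marginal preferences of its two members. -/
def CoupleResponsive (P : Profile D H) (c : D × D) : Prop :=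
  StrictLinear (P.cpref c) ∧ StrictLinear (P.dpref c.1) ∧ StrictLinear (P.dpref c.2) ∧
  (∀ h h₁ h₂ : Option H,
    (P.cpref c (h₁, h) (h₂, h) ↔ P.dpref c.1 h₁ h₂) ∧
    (P.cpref c (h, h₁) (h, h₂) ↔ P.dpref c.2 h₁ h₂))

/-- A fully responsive preference profile. -/
def Responsive (M : Market D H) (P : Profile D H) : Prop :=
  (∀ h : H, HospResponsive M P h) ∧
  (∀ c ∈ M.couples, CoupleResponsive P c) ∧
  (∀ d : D, M.Single d → StrictLinear (P.dpref d))

/-- A matching: each doctor is assigned a hospital in `H ∪ {λ}` (where `none`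
means unemployed), respecting capacities.  (Disjointness of the hospitals'
sets of doctors is automatic, and the dummy hospital has capacity `|D|`.) -/
structure Matching {D H : Type} [Fintype D] [DecidableEq D] [DecidableEq H]
    (M : Market D H) : Type where
  assign : D → Option H
  quota : ∀ h : H, (Finset.univ.filter fun d => assign d = some h).card ≤ M.κ h

/-- `μ(h)`, the set of doctors matched with hospital `h`. -/
def Matching.assigned {M : Market D H} (μ : Matching M) (h : H) : Finset D :=
  Finset.univ.filter fun d => μ.assign d = some h

/-- Hospital `h ∈ H ∪ {λ}` prefers the set of doctors `A` to (a subset of) its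
assignment at `μ`: there is `B ⊆ μ(h)` disjoint from `A` such that the feasible
set `(μ(h) \ B) ∪ A` is preferred to `μ(h)`.  The dummy hospital always
prefers to have any doctors. -/
def HosPrefers (M : Market D H) (P : Profile D H) (μ : Matching M) :
    Option H → Finset D → Prop
  | none, _ => True
  | some h, A => ∃ B ⊆ μ.assigned h, Disjoint A B ∧
      ((μ.assigned h \ B) ∪ A).card ≤ M.κ h ∧
      P.hpref h ((μ.assigned h \ B) ∪ A) (μ.assigned h)

/-- The pair `(h, s)` (hospital or dummy, single doctor) blocks `μ`. -/
def BlocksSingle (M : Market D H) (P : Profile D H) (μ : Matching M)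
    (h : Option H) (s : D) : Prop :=
  P.dpref s h (μ.assign s) ∧ HosPrefers M P μ h {s}

/-- The pair `((h_f, h_m), c)` (pair of hospitals or dummies, couple `c = (f, m)`)
blocks `μ`. -/
def BlocksCouple (M : Market D H) (P : Profile D H) (μ : Matching M)
    (hf hm : Option H) (c : D × D) : Prop :=
  P.cpref c (hf, hm) (μ.assign c.1, μ.assign c.2) ∧
  (hf ≠ hm → μ.assign c.1 ≠ hf → HosPrefers M P μ hf {c.1}) ∧
  (hf ≠ hm → μ.assign c.2 ≠ hm → HosPrefers M P μ hm {c.2}) ∧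
  (hf = hm → HosPrefers M P μ hf {c.1, c.2})

/-- Stability: no single blocking pair, no couple blocking pair, and no
hospital prefers `∅` to its assignment. -/
def Stable (M : Market D H) (P : Profile D H) (μ : Matching M) : Prop :=
  (∀ (h : Option H) (s : D), M.Single s → ¬ BlocksSingle M P μ h s) ∧
  (∀ (hf hm : Option H), ∀ c ∈ M.couples, ¬ BlocksCouple M P μ hf hm c) ∧
  (∀ h : H, ¬ HosPrefers M P μ (some h) ∅)

/-- Individual rationality. -/
def IndivRational (M : Market D H) (P : Profile D H) (μ : Matching M) : Prop :=
  (∀ s : D, M.Single s → weakPref (P.dpref s) (μ.assign s) none) ∧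
  (∀ c ∈ M.couples, weakPref (P.cpref c) (μ.assign c.1, μ.assign c.2) (none, none)) ∧
  (∀ h : H, ∀ d ∈ μ.assigned h, d ∈ P.acc h)

/-- Extreme-altruism of the profile of couple preferences: for every couple
`c = (f, m)`, every hospital `h` with `κ_h ≤ |D| - 2` and all
`h', h'' ∈ H ∪ {λ}`:  (i) `h' P_f h`, `h' R_f h''` and `h'' R_m λ` imply
`(h', h'') P_c (h, h)`; and (ii) symmetrically for `m`. -/
def ExtremeAltruism (M : Market D H) (P : Profile D H) : Prop :=
  ∀ c ∈ M.couples, ∀ h : H, M.κ h ≤ Fintype.card D - 2 →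
    ∀ h' h'' : Option H,
      ((P.dpref c.1 h' (some h) ∧ weakPref (P.dpref c.1) h' h'' ∧
          weakPref (P.dpref c.2) h'' none) →
        P.cpref c (h', h'') (some h, some h)) ∧
      ((P.dpref c.2 h' (some h) ∧ weakPref (P.dpref c.2) h' h'' ∧
          weakPref (P.dpref c.1) h'' none) →
        P.cpref c (h'', h') (some h, some h))

/-- Aversion to couple diversity of the profile of hospital preferences: for
every hospital `h`, every couple `c = (f, m)` of acceptable doctors and all
doctors `d₁, d₂` ranked strictly in between `f` and `m` by `h`, if more than
`κ_h` doctors are ranked above the worse member of the couple then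
`{d₁, d₂} P_h {f, m}`. -/
def AversionToCoupleDiversity (M : Market D H) (P : Profile D H) : Prop :=
  ∀ h : H, ∀ c ∈ M.couples, c.1 ∈ P.acc h → c.2 ∈ P.acc h → ∀ d₁ d₂ : D,
    ((P.rank h c.1 d₁ ∧ P.rank h d₁ d₂ ∧ P.rank h d₂ c.2 ∧
        M.κ h < {d : D | P.rank h d c.2}.ncard) ∨
     (P.rank h c.2 d₁ ∧ P.rank h d₁ d₂ ∧ P.rank h d₂ c.1 ∧
        M.κ h < {d : D | P.rank h d c.1}.ncard)) →
    P.hpref h {d₁, d₂} {c.1, c.2}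

/-- `P` is an extension of the profile `P₀` of couple preferences: the couple
preferences (and hence their induced marginals) agree with `P₀`. -/
def CoupleExtension (M : Market D H) (P₀ P : Profile D H) : Prop :=
  ∀ c ∈ M.couples, P.cpref c = P₀.cpref c ∧
    P.dpref c.1 = P₀.dpref c.1 ∧ P.dpref c.2 = P₀.dpref c.2

/-- `P` is an extension of the profile `P₀` of hospital preferences: the
hospital preferences (including the sets of acceptable doctors) agree with `P₀`. -/
def HospitalExtension (P₀ P : Profile D H) : Prop :=
  ∀ h : H, P.acc h = P₀.acc h ∧ P.rank h = P₀.rank h ∧ P.hpref h = P₀.hpref h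

end CouplesMarket

namespace CouplesMarket

section DeferredAcceptance

variable {D H : Type} [Fintype D] [DecidableEq D] [Fintype H] [DecidableEq H]

/-- A strict linear order has a best element on every nonempty finite set. -/
theorem StrictLinear.exists_best {α : Type} {r : α → α → Prop} (hr : StrictLinear r)
    (s : Finset α) (hs : s.Nonempty) : ∃ x ∈ s, ∀ y ∈ s, y = x ∨ r x y := by
  classical
  obtain ⟨htri, -, htrans, -⟩ := hr
  induction hs using Finset.Nonempty.cons_induction with
  | singleton a => exact ⟨a, by simp, by simp⟩
  | cons a s ha _ ih =>
    obtain ⟨x, hx, hbest⟩ := ih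
    rcases htri a trivial x trivial with h | h | h
    · exact absurd (h ▸ hx) ha
    · refine ⟨a, by simp, fun y hy => ?_⟩
      rcases Finset.mem_cons.1 hy with rfl | hy
      · exact Or.inl rfl
      · rcases hbest y hy with rfl | hxy
        · exact Or.inr h
        · exact Or.inr (htrans a trivial x trivial y trivial h hxy)
    · refine ⟨x, by simp [hx], fun y hy => ?_⟩
      rcases Finset.mem_cons.1 hy with rfl | hy
      · exact Or.inr h
      · exact hbest y hy

/-- A strict linear order on `t` has a worst element on every nonempty finite subset of `t`. -/
theorem StrictLinearOn.exists_worst {α : Type} {t : Set α} {r : α → α → Prop}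
    (hr : StrictLinearOn t r) (s : Finset α) (hs : s.Nonempty) (hst : ∀ x ∈ s, x ∈ t) :
    ∃ x ∈ s, ∀ y ∈ s, y = x ∨ r y x := by
  classical
  obtain ⟨htri, -, htrans, -⟩ := hr
  induction hs using Finset.Nonempty.cons_induction with
  | singleton a => exact ⟨a, by simp, by simp⟩
  | cons a s ha _ ih =>
    obtain ⟨x, hx, hworst⟩ := ih fun y hy => hst y (by simp [hy])
    have hat := hst a (by simp)
    have hxt := hst x (by simp [hx])
    rcases htri a hat x hxt with h | h | h
    · exact absurd (h ▸ hx) ha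
    · refine ⟨x, by simp [hx], fun y hy => ?_⟩
      rcases Finset.mem_cons.1 hy with rfl | hy
      · exact Or.inr h
      · exact hworst y hy
    · refine ⟨a, by simp, fun y hy => ?_⟩
      rcases Finset.mem_cons.1 hy with rfl | hy'
      · exact Or.inl rfl
      · rcases hworst y hy' with rfl | hyx
        · exact Or.inr h
        · exact Or.inr (htrans y (hst y hy) x hxt a hat hyx h)

/-- The doctors applying to `h` at `a` that `h` finds acceptable and ranks above `d`. -/
noncomputable def rivals (P : Profile D H) (a : D → Option H) (h : H) (d : D) : Finset D := by
  classical
  exact Finset.univ.filter fun d' => a d' = some h ∧ d' ∈ P.acc h ∧ P.rank h d' d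

/-- The invariant of doctor-proposing deferred acceptance: nobody applies below the dummy
hospital, and every application already given up was to a hospital that still has good reason
to reject it. -/
def ProposalInvariant (M : Market D H) (P : Profile D H) (a : D → Option H) : Prop :=
  (∀ d, weakPref (P.dpref d) (a d) none) ∧
  ∀ d h, P.dpref d (some h) (a d) → d ∉ P.acc h ∨ M.κ h ≤ (rivals P a h d).card

/-- Some applicant `d` of `h` is unacceptable or has too many rivals. -/
def Overdemanded (M : Market D H) (P : Profile D H) (a : D → Option H) (h : H) (d : D) : Prop :=
  a d = some h ∧ (d ∉ P.acc h ∨ M.κ h ≤ (rivals P a h d).card)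

/-- A rejected doctor can move on to the next best option without breaking the invariant. -/
theorem ProposalInvariant.advance {M : Market D H} {P : Profile D H} {a : D → Option H}
    (hacc : ∀ h, StrictLinearOn {d | d ∈ P.acc h} (P.rank h))
    (hlin : ∀ d, StrictLinear (P.dpref d)) (ha : ProposalInvariant M P a)
    {h : H} {d : D} (hd : Overdemanded M P a h d) :
    ∃ x, P.dpref d (a d) x ∧ ProposalInvariant M P (Function.update a d x) := by
  classical
  obtain ⟨hdh, hrej⟩ := hd
  have hnone : P.dpref d (a d) none := by
    rcases ha.1 d with h' | h'
    · simp [hdh] at h'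
    · exact h'
  obtain ⟨x, hx, hbest⟩ := (hlin d).exists_best
    (Finset.univ.filter fun y => P.dpref d (a d) y) ⟨none, by simpa using hnone⟩
  simp only [Finset.mem_filter, Finset.mem_univ, true_and] at hx hbest
  have hself : ∀ h', d ∉ rivals P a h' d := fun h' hm => by
    simp only [rivals, Finset.mem_filter, Finset.mem_univ, true_and] at hm
    exact (hacc h').2.1 d hm.2.1 hm.2.2
  have keep : ∀ h' e, d ∉ rivals P a h' e →
      rivals P a h' e ⊆ rivals P (Function.update a d x) h' e := by
    intro h' e hde d' hd'
    have hne : d' ≠ d := fun h => hde (h ▸ hd')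
    simpa [rivals, Function.update_of_ne hne] using hd'
  have persist : ∀ e h', (e ∉ P.acc h' ∨ M.κ h' ≤ (rivals P a h' e).card) →
      e ∉ P.acc h' ∨ M.κ h' ≤ (rivals P (Function.update a d x) h' e).card := by
    intro e h' hrej'
    by_cases he : e ∈ P.acc h'
    swap
    · exact Or.inl he
    refine Or.inr ?_
    by_cases hde : d ∈ rivals P a h' e
    · have hmem : a d = some h' ∧ d ∈ P.acc h' ∧ P.rank h' d e := by simpa [rivals] using hde
      obtain rfl : h = h' := by simpa [hdh] using hmem.1
      have hκ : M.κ h ≤ (rivals P a h d).card := hrej.resolve_left (not_not.2 hmem.2.1)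
      refine hκ.trans (Finset.card_le_card ((keep h d (hself h)).trans fun d' hd' => ?_))
      simp only [rivals, Finset.mem_filter, Finset.mem_univ, true_and] at hd' ⊢
      exact ⟨hd'.1, hd'.2.1, (hacc h).2.2.1 d' hd'.2.1 d hmem.2.1 e he hd'.2.2 hmem.2.2⟩
    · exact (hrej'.resolve_left (not_not.2 he)).trans (Finset.card_le_card (keep h' e hde))
  refine ⟨x, hx, fun e => ?_, fun e h' hpref => persist e h' ?_⟩
  · by_cases hed : e = d
    · subst hed
      rw [Function.update_self]
      exact (hbest none hnone).imp Eq.symm id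
    · rw [Function.update_of_ne hed]
      exact ha.1 e
  · by_cases hed : e = d
    · subst hed
      rw [Function.update_self] at hpref
      rcases (hlin e).1 (some h') trivial (a e) trivial with heq | hgt | hlt
      · obtain rfl : h = h' := by simpa [hdh] using heq.symm
        exact hrej
      · exact ha.2 e h' hgt
      · rcases hbest _ hlt with heq | hxh
        · rw [heq] at hpref
          exact absurd hpref ((hlin e).2.1 x trivial)
        · exact absurd hpref ((hlin e).2.2.2 x trivial _ trivial hxh)
    · rw [Function.update_of_ne hed] at hpref
      exact ha.2 e h' hpref

/-- Deferred acceptance terminates: some proposal profile has no overdemanded hospital. -/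
theorem exists_proposalInvariant_not_overdemanded (M : Market D H) (P : Profile D H)
    (hacc : ∀ h, StrictLinearOn {d | d ∈ P.acc h} (P.rank h))
    (hlin : ∀ d, StrictLinear (P.dpref d)) :
    ∃ a, ProposalInvariant M P a ∧ ∀ h d, ¬ Overdemanded M P a h d := by
  classical
  let better : (D → Option H) → D → Finset (Option H) := fun a d =>
    Finset.univ.filter fun y => P.dpref d y (a d)
  choose top _ htop using fun d => (hlin d).exists_best Finset.univ Finset.univ_nonempty
  have hinit : ProposalInvariant M P top := by
    refine ⟨fun d => (htop d none (Finset.mem_univ _)).imp Eq.symm id, fun d h hpref => ?_⟩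
    rcases htop d (some h) (Finset.mem_univ _) with heq | hlt
    · rw [heq] at hpref
      exact absurd hpref ((hlin d).2.1 _ trivial)
    · exact absurd hpref ((hlin d).2.2.2 _ trivial _ trivial hlt)
  obtain ⟨a, ha, hmax⟩ := Finset.exists_max_image
    (Finset.univ.filter fun a : D → Option H => ProposalInvariant M P a)
    (fun a => ∑ d, (better a d).card) ⟨top, by simpa using hinit⟩
  simp only [Finset.mem_filter, Finset.mem_univ, true_and] at ha hmax
  refine ⟨a, ha, fun h d hd => ?_⟩
  obtain ⟨x, hx, hinv⟩ := ha.advance hacc hlin hd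
  refine absurd (hmax _ hinv) (not_le.2 (Finset.sum_lt_sum (fun e _ => ?_)
    ⟨d, Finset.mem_univ _, Finset.card_lt_card (Finset.ssubset_iff_subset_ne.2 ⟨?_, ?_⟩)⟩))
  · by_cases hed : e = d
    · subst hed
      refine Finset.card_le_card fun y hy => ?_
      simp only [better, Finset.mem_filter, Finset.mem_univ, true_and,
        Function.update_self] at hy ⊢
      exact (hlin e).2.2.1 _ trivial _ trivial _ trivial hy hx
    · simp [better, Function.update_of_ne hed]
  · intro y hy
    simp only [better, Finset.mem_filter, Finset.mem_univ, true_and, Function.update_self] at hy ⊢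
    exact (hlin d).2.2.1 _ trivial _ trivial _ trivial hy hx
  · intro heq
    have hmem : a d ∈ better (Function.update a d x) d := by simpa [better] using hx
    rw [← heq] at hmem
    simp only [better, Finset.mem_filter, Finset.mem_univ, true_and] at hmem
    exact (hlin d).2.1 _ trivial hmem

/-- Hospital `h` is full of acceptable doctors ranked above `d`, or finds `d` unacceptable. -/
def Rejects (M : Market D H) (P : Profile D H) (h : H) (S : Finset D) (d : D) : Prop :=
  d ∉ P.acc h ∨ (M.κ h ≤ S.card ∧ ∀ d' ∈ S, P.rank h d' d)

/-- When couples are split and all doctors act on their own (marginal) preferences, a stable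
matching exists. -/
theorem exists_individually_stable (M : Market D H) (P : Profile D H)
    (hacc : ∀ h, StrictLinearOn {d | d ∈ P.acc h} (P.rank h))
    (hlin : ∀ d, StrictLinear (P.dpref d)) :
    ∃ μ : Matching M, (∀ h, μ.assigned h ⊆ P.acc h) ∧
      (∀ d, weakPref (P.dpref d) (μ.assign d) none) ∧
      ∀ d h, P.dpref d (some h) (μ.assign d) → Rejects M P h (μ.assigned h) d := by
  classical
  obtain ⟨a, ha, hdem⟩ := exists_proposalInvariant_not_overdemanded M P hacc hlin
  have hsub : ∀ h, (Finset.univ.filter fun d => a d = some h) ⊆ P.acc h := by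
    intro h d hd
    by_contra hd'
    exact hdem h d ⟨by simpa using hd, Or.inl hd'⟩
  have hquota : ∀ h, (Finset.univ.filter fun d => a d = some h).card ≤ M.κ h := by
    intro h
    rcases (Finset.univ.filter fun d => a d = some h).eq_empty_or_nonempty with hS | hS
    · simp [hS]
    obtain ⟨w, hw, hworst⟩ := (hacc h).exists_worst _ hS (hsub h)
    have hlt : (rivals P a h w).card < M.κ h := by
      by_contra hge
      exact hdem h w ⟨by simpa using hw, Or.inr (not_lt.1 hge)⟩
    have herase : (Finset.univ.filter fun d => a d = some h).erase w ⊆ rivals P a h w := by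
      intro d hd
      rw [Finset.mem_erase] at hd
      have hda := hsub h hd.2
      have hrank := (hworst d hd.2).resolve_left hd.1
      simp only [Finset.mem_filter, Finset.mem_univ, true_and] at hd
      simp [rivals, hd.2, hda, hrank]
    have := Finset.card_le_card herase
    rw [Finset.card_erase_of_mem hw] at this
    omega
  refine ⟨⟨a, hquota⟩, hsub, ha.1, fun d h hpref => ?_⟩
  refine (ha.2 d h hpref).imp id fun hκ => ?_
  have hriv : rivals P a h d ⊆ Finset.univ.filter fun d => a d = some h := by
    intro d' hd'
    simp only [rivals, Finset.mem_filter, Finset.mem_univ, true_and] at hd' ⊢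
    exact hd'.1
  refine ⟨hκ.trans (Finset.card_le_card hriv), fun d' hd' => ?_⟩
  have heq := Finset.eq_of_subset_of_card_le hriv ((hquota h).trans hκ)
  have hmem : d' ∈ rivals P a h d := heq ▸ hd'
  simp only [rivals, Finset.mem_filter, Finset.mem_univ, true_and] at hmem
  exact hmem.2.2

end DeferredAcceptance

section HospResponsive

variable {D H : Type} [DecidableEq D] {M : Market D H} {P : Profile D H} {h : H}

/-- Adding a set of common acceptable doctors preserves comparisons. -/
theorem HospResponsive.hpref_union (hR : HospResponsive M P h) {A B T : Finset D}
    (hA : A ⊆ P.acc h) (hB : B ⊆ P.acc h) (hT : T ⊆ P.acc h)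
    (hAT : Disjoint A T) (hBT : Disjoint B T)
    (hAc : (A ∪ T).card ≤ M.κ h) (hBc : (B ∪ T).card ≤ M.κ h) (hAB : P.hpref h A B) :
    P.hpref h (A ∪ T) (B ∪ T) := by
  induction T using Finset.induction_on with
  | empty => simpa using hAB
  | insert d T hd ih =>
    rw [Finset.disjoint_insert_right] at hAT hBT
    rw [Finset.insert_subset_iff] at hT
    have hdA : d ∉ A ∪ T := by simp [hAT.1, hd]
    have hdB : d ∉ B ∪ T := by simp [hBT.1, hd]
    rw [Finset.union_insert, Finset.card_insert_of_notMem hdA] at hAc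
    rw [Finset.union_insert, Finset.card_insert_of_notMem hdB] at hBc
    rw [Finset.union_insert, Finset.union_insert]
    exact (hR.2.2.2.2.1 _ _ (Finset.union_subset hA hT.2) (Finset.union_subset hB hT.2)
      (by omega) (by omega) d hT.1 hdA hdB).2
      (ih hT.2 hAT.2 hBT.2 (by omega) (by omega))

/-- Larger feasible sets of acceptable doctors are weakly better. -/
theorem HospResponsive.weakPref_of_subset (hR : HospResponsive M P h) {A B : Finset D}
    (hAB : A ⊆ B) (hB : B ⊆ P.acc h) (hBc : B.card ≤ M.κ h) :
    weakPref (P.hpref h) B A := by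
  rcases (B \ A).eq_empty_or_nonempty with hE | hE
  · exact Or.inl ((Finset.sdiff_eq_empty_iff_subset.1 hE).antisymm hAB)
  · have hle := (Finset.card_le_card (Finset.sdiff_subset (s := B) (t := A))).trans hBc
    have := hR.hpref_union (T := A) (Finset.sdiff_subset.trans hB) (Finset.empty_subset _)
      (hAB.trans hB) Finset.sdiff_disjoint (Finset.disjoint_empty_left _)
      (by rwa [Finset.sdiff_union_of_subset hAB])
      (by simpa using (Finset.card_le_card hAB).trans hBc)
      (hR.2.2.1 (B \ A) (Finset.sdiff_subset.trans hB) hE hle)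
    rw [Finset.sdiff_union_of_subset hAB, Finset.empty_union] at this
    exact Or.inr this

/-- A set cannot beat `S` if `S` beats one of its feasible acceptable supersets. -/
theorem HospResponsive.not_hpref_of_subset (hR : HospResponsive M P h) {A B S : Finset D}
    (hSc : S.card ≤ M.κ h) (hAB : A ⊆ B) (hB : B ⊆ P.acc h) (hBc : B.card ≤ M.κ h)
    (hSB : P.hpref h S B) : ¬ P.hpref h A S := by
  have hAc := (Finset.card_le_card hAB).trans hBc
  refine hR.2.1.2.2.2 S hSc A hAc ?_
  rcases hR.weakPref_of_subset hAB hB hBc with rfl | hBA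
  · exact hSB
  · exact hR.2.1.2.2.1 S hSc B hBc A hAc hSB hBA

/-- No set containing an unacceptable doctor beats a feasible set of acceptable doctors. -/
theorem HospResponsive.not_hpref_of_notMem_acc (hR : HospResponsive M P h) {A S : Finset D}
    (hS : S ⊆ P.acc h) (hSc : S.card ≤ M.κ h) (hAc : A.card ≤ M.κ h)
    {d : D} (hdA : d ∈ A) (hd : d ∉ P.acc h) : ¬ P.hpref h A S := by
  have hA := hR.2.2.2.2.2 A hAc fun hsub => hd (hsub hdA)
  refine hR.2.1.2.2.2 S hSc A hAc ?_
  rcases hR.weakPref_of_subset (Finset.empty_subset S) hS hSc with rfl | hE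
  · exact hA
  · exact hR.2.1.2.2.1 S hSc ∅ (Nat.zero_le _) A hAc hE hA

/-- A hospital does not want to swap anybody for a doctor it rejects. -/
theorem HospResponsive.not_hpref_singleton (hR : HospResponsive M P h) {S B : Finset D} {x : D}
    (hS : S ⊆ P.acc h) (hSc : S.card ≤ M.κ h) (hx : Rejects M P h S x) (hxS : x ∉ S)
    (hB : B ⊆ S) (hc : ((S \ B) ∪ {x}).card ≤ M.κ h) : ¬ P.hpref h ((S \ B) ∪ {x}) S := by
  rcases em' (x ∈ P.acc h) with hxa | hxa
  · exact hR.not_hpref_of_notMem_acc hS hSc hc (by simp) hxa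
  obtain ⟨hfull, hbetter⟩ := hx.resolve_left (not_not.2 hxa)
  have hBne : B.Nonempty := by
    by_contra hE
    rw [Finset.not_nonempty_iff_eq_empty] at hE
    subst hE
    rw [Finset.sdiff_empty, Finset.union_comm, ← Finset.insert_eq,
      Finset.card_insert_of_notMem hxS] at hc
    omega
  obtain ⟨b, hb⟩ := hBne
  have hbS := hB hb
  have hcard := Finset.card_erase_add_one hbS
  have hbx : b ≠ x := fun hbx => hxS (hbx ▸ hbS)
  have hxE : x ∉ S.erase b := fun hm => hxS (Finset.mem_of_mem_erase hm)
  have hE : S.erase b ⊆ P.acc h := (Finset.erase_subset _ _).trans hS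
  have hins : insert x (S.erase b) = {x} ∪ S.erase b := Finset.insert_eq _ _
  refine hR.not_hpref_of_subset (B := insert x (S.erase b)) hSc ?_
    (Finset.insert_subset hxa hE) ?_ ?_
  · intro d hd
    simp only [Finset.mem_union, Finset.mem_sdiff, Finset.mem_singleton, Finset.mem_insert,
      Finset.mem_erase] at hd ⊢
    rcases hd with ⟨hdS, hdB⟩ | hd
    · exact Or.inr ⟨fun hdb => hdB (hdb ▸ hb), hdS⟩
    · exact Or.inl hd
  · rw [Finset.card_insert_of_notMem hxE]
    omega
  · have := hR.hpref_union (A := {b}) (B := {x}) (T := S.erase b)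
      (by simpa using hS hbS) (by simpa using hxa) hE (by simp) (by simpa using hxE)
      (by rw [← Finset.insert_eq, Finset.insert_erase hbS]; exact hSc)
      (by rw [← hins, Finset.card_insert_of_notMem hxE]; omega)
      ((hR.2.2.2.1 b (hS hbS) x hxa hbx).2 (hbetter b hbS))
    rwa [← hins, ← Finset.insert_eq, Finset.insert_erase hbS] at this

/-- Under aversion to couple diversity, a pair of assigned doctors beats a couple one of whose
members is rejected. -/
theorem HospResponsive.hpref_pair [Finite D] (hR : HospResponsive M P h) (hκ : 2 ≤ M.κ h)
    {S : Finset D} {x y b₁ b₂ : D} (hS : S ⊆ P.acc h) (hfull : M.κ h ≤ S.card)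
    (hbetter : ∀ d ∈ S, P.rank h d x) (hxS : x ∉ S) (hyS : y ∉ S) (hxy : x ≠ y)
    (hxa : x ∈ P.acc h) (hya : y ∈ P.acc h)
    (hb₁ : b₁ ∈ S) (hb₂ : b₂ ∈ S) (hb : P.rank h b₁ b₂)
    (hAv : ∀ d₁ d₂, P.rank h y d₁ → P.rank h d₁ d₂ → P.rank h d₂ x →
      M.κ h < {d : D | P.rank h d x}.ncard → P.hpref h {d₁, d₂} {x, y}) :
    P.hpref h {b₁, b₂} {x, y} := by
  have hb₁y : b₁ ≠ y := fun e => hyS (e ▸ hb₁)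
  have hb₂x : b₂ ≠ x := fun e => hxS (e ▸ hb₂)
  have hb₁x : b₁ ≠ x := fun e => hxS (e ▸ hb₁)
  have hb₁₂ : b₁ ≠ b₂ := fun e => by
    subst e
    exact hR.1.2.1 b₁ (hS hb₁) hb
  rcases hR.1.1 y hya b₁ (hS hb₁) with e | hyb | hby
  · exact absurd e.symm hb₁y
  · refine hAv b₁ b₂ hyb hb (hbetter b₂ hb₂) ?_
    have hyx := hR.1.2.2.1 y hya b₁ (hS hb₁) x hxa hyb (hbetter b₁ hb₁)
    have hsub : (↑(insert y S) : Set D) ⊆ {d : D | P.rank h d x} := by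
      intro d hd
      rcases Finset.mem_insert.1 (Finset.mem_coe.1 hd) with rfl | hd
      · exact hyx
      · exact hbetter d hd
    have := Set.ncard_le_ncard hsub (Set.toFinite _)
    rw [Set.ncard_coe_finset, Finset.card_insert_of_notMem hyS] at this
    omega
  · have hone : ∀ d : D, ({d} : Finset D).card < M.κ h := fun d => by
      rw [Finset.card_singleton]
      omega
    have h₁ : P.hpref h {b₁, b₂} {b₁, x} :=
      (hR.2.2.2.2.1 {b₂} {x} (by simpa using hS hb₂) (by simpa using hxa) (hone _) (hone _)
        b₁ (hS hb₁) (by simpa using hb₁₂) (by simpa using hb₁x)).2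
        ((hR.2.2.2.1 b₂ (hS hb₂) x hxa hb₂x).2 (hbetter b₂ hb₂))
    have h₂ : P.hpref h {x, b₁} {x, y} :=
      (hR.2.2.2.2.1 {b₁} {y} (by simpa using hS hb₁) (by simpa using hya) (hone _) (hone _)
        x hxa (by simpa using hb₁x.symm) (by simpa using hxy)).2
        ((hR.2.2.2.1 b₁ (hS hb₁) y hya hb₁y).2 hby)
    rw [Finset.pair_comm x b₁] at h₂
    exact hR.2.1.2.2.1 _ (Finset.card_le_two.trans hκ) _ (Finset.card_le_two.trans hκ) _
      (Finset.card_le_two.trans hκ) h₁ h₂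

/-- Under aversion to couple diversity, a hospital does not want to swap anybody for a couple
one of whose members it rejects. -/
theorem HospResponsive.not_hpref_pair [Finite D] (hR : HospResponsive M P h) (hκ : 2 ≤ M.κ h)
    {S B : Finset D} {x y : D} (hS : S ⊆ P.acc h) (hSc : S.card ≤ M.κ h)
    (hx : Rejects M P h S x) (hxS : x ∉ S) (hxy : x ≠ y) (hB : B ⊆ S) (hyB : y ∉ B)
    (hc : ((S \ B) ∪ {x, y}).card ≤ M.κ h)
    (hAv : x ∈ P.acc h → y ∈ P.acc h → ∀ d₁ d₂, P.rank h y d₁ → P.rank h d₁ d₂ →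
      P.rank h d₂ x → M.κ h < {d : D | P.rank h d x}.ncard → P.hpref h {d₁, d₂} {x, y}) :
    ¬ P.hpref h ((S \ B) ∪ {x, y}) S := by
  rcases em' (x ∈ P.acc h) with hxa | hxa
  · exact hR.not_hpref_of_notMem_acc hS hSc hc (by simp) hxa
  rcases em' (y ∈ P.acc h) with hya | hya
  · exact hR.not_hpref_of_notMem_acc hS hSc hc (by simp) hya
  by_cases hyS : y ∈ S
  · have heq : (S \ B) ∪ {x, y} = (S \ B) ∪ {x} := by
      ext d
      simp only [Finset.mem_union, Finset.mem_sdiff, Finset.mem_insert, Finset.mem_singleton]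
      constructor
      · rintro (hd | hd | rfl)
        exacts [Or.inl hd, Or.inr hd, Or.inl ⟨hyS, hyB⟩]
      · tauto
    rw [heq] at hc ⊢
    exact hR.not_hpref_singleton hS hSc hx hxS hB hc
  obtain ⟨hfull, hbetter⟩ := hx.resolve_left (not_not.2 hxa)
  have hBc : 1 < B.card := by
    have hdisj : Disjoint (S \ B) {x, y} := by
      simp [Finset.disjoint_insert_right, hxS, hyS]
    rw [Finset.card_union_of_disjoint hdisj, Finset.card_pair hxy,
      Finset.card_sdiff_of_subset hB] at hc
    have := Finset.card_le_card hB
    omega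
  obtain ⟨b₁, hb₁, b₂, hb₂, hb⟩ : ∃ b₁ ∈ B, ∃ b₂ ∈ B, P.rank h b₁ b₂ := by
    obtain ⟨b₁, hb₁, b₂, hb₂, hne⟩ := Finset.one_lt_card.1 hBc
    rcases hR.1.1 b₁ (hS (hB hb₁)) b₂ (hS (hB hb₂)) with e | hr | hr
    · exact absurd e hne
    · exact ⟨b₁, hb₁, b₂, hb₂, hr⟩
    · exact ⟨b₂, hb₂, b₁, hb₁, hr⟩
  have hb₁₂ : b₁ ≠ b₂ := fun e => by
    subst e
    exact hR.1.2.1 b₁ (hS (hB hb₁)) hb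
  have hpair : ({b₁, b₂} : Finset D) ⊆ S := by
    simp [Finset.insert_subset_iff, hB hb₁, hB hb₂]
  have hT : S \ {b₁, b₂} ⊆ P.acc h := Finset.sdiff_subset.trans hS
  have hxyT : Disjoint ({x, y} : Finset D) (S \ {b₁, b₂}) := by
    simp [Finset.disjoint_insert_left, hxS, hyS]
  have hxya : ({x, y} : Finset D) ⊆ P.acc h := by
    simp [Finset.insert_subset_iff, hxa, hya]
  have hsplit : ({b₁, b₂} : Finset D) ∪ (S \ {b₁, b₂}) = S :=
    Finset.union_sdiff_of_subset hpair
  have hcard : (({x, y} : Finset D) ∪ (S \ {b₁, b₂})).card ≤ M.κ h := by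
    have hle := Finset.card_le_card hpair
    rw [Finset.card_pair hb₁₂] at hle
    rw [Finset.card_union_of_disjoint hxyT, Finset.card_pair hxy,
      Finset.card_sdiff_of_subset hpair, Finset.card_pair hb₁₂]
    omega
  refine hR.not_hpref_of_subset (B := {x, y} ∪ (S \ {b₁, b₂})) hSc ?_
    (Finset.union_subset hxya hT) hcard ?_
  · rw [Finset.union_comm]
    refine Finset.union_subset_union le_rfl (Finset.sdiff_subset_sdiff le_rfl ?_)
    simp [Finset.insert_subset_iff, hb₁, hb₂]
  · have := hR.hpref_union (T := S \ {b₁, b₂}) (hpair.trans hS) hxya hT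
      Finset.disjoint_sdiff hxyT (by rwa [hsplit]) hcard
      (hR.hpref_pair hκ hS hfull hbetter hxS hyS hxy hxa hya (hB hb₁) (hB hb₂) hb
        (hAv hxa hya))
    rwa [hsplit] at this

end HospResponsive

/-- If a couple prefers one pair of hospitals to another, then one of its members prefers their
own hospital in the first pair. -/
theorem CoupleResponsive.exists_improves {D H : Type} {P : Profile D H} {c : D × D}
    (hR : CoupleResponsive P c) {h₁ h₂ k₁ k₂ : Option H} (hp : P.cpref c (h₁, h₂) (k₁, k₂)) :
    P.dpref c.1 h₁ k₁ ∨ P.dpref c.2 h₂ k₂ := by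
  obtain ⟨hc, hf, hm, hmarg⟩ := hR
  by_contra hno
  rw [not_or] at hno
  have hf' : weakPref (P.cpref c) (k₁, k₂) (h₁, k₂) := by
    rcases hf.1 h₁ trivial k₁ trivial with rfl | h | h
    · exact Or.inl rfl
    · exact absurd h hno.1
    · exact Or.inr ((hmarg k₂ k₁ h₁).1.2 h)
  have hm' : weakPref (P.cpref c) (h₁, k₂) (h₁, h₂) := by
    rcases hm.1 h₂ trivial k₂ trivial with rfl | h | h
    · exact Or.inl rfl
    · exact absurd h hno.2
    · exact Or.inr ((hmarg h₁ k₂ h₂).2.2 h)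
  have hweak : weakPref (P.cpref c) (k₁, k₂) (h₁, h₂) := by
    rcases hf' with e | hf'
    · exact e ▸ hm'
    · rcases hm' with e | hm'
      · exact Or.inr (e ▸ hf')
      · exact Or.inr (hc.2.2.1 _ trivial _ trivial _ trivial hf' hm')
  rcases hweak with e | hlt
  · rw [e] at hp
    exact hc.2.1 _ trivial hp
  · exact hc.2.2.2 _ trivial _ trivial hp hlt

/-- In a responsive profile every doctor's individual preference is a strict linear order. -/
theorem Responsive.strictLinear_dpref {D H : Type} [DecidableEq D] {M : Market D H}
    {P : Profile D H} (hR : Responsive M P) (d : D) : StrictLinear (P.dpref d) := by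
  by_cases hd : M.Single d
  · exact hR.2.2 d hd
  · simp only [Market.Single, not_forall, not_and_or, not_not] at hd
    obtain ⟨c, hc, rfl | rfl⟩ := hd
    · exact (hR.2.1 c hc).2.1
    · exact (hR.2.1 c hc).2.2.1

/-- **Theorem (part (i))**: if the profile `P₀` of responsive hospital
preferences satisfies aversion to couple diversity, then every responsive
extension of `P₀` admits a stable matching. -/
theorem aversion_implies_stable_exists
    {D H : Type} [Fintype D] [DecidableEq D] [Fintype H] [DecidableEq H]
    (M : Market D H)
    (hH : 2 ≤ Fintype.card H) (hD : 4 ≤ Fintype.card D)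
    (hC : M.couples.Nonempty) (hκ : ∀ h : H, 2 ≤ M.κ h)
    (P₀ : Profile D H) (hP₀ : ∀ h : H, HospResponsive M P₀ h)
    (hAv : AversionToCoupleDiversity M P₀)
    (P : Profile D H) (hresp : Responsive M P) (hext : HospitalExtension P₀ P) :
    ∃ μ : Matching M, Stable M P μ := by
  have hAv' : AversionToCoupleDiversity M P := by
    intro h c hc hf hm d₁ d₂ hd
    obtain ⟨e₁, e₂, e₃⟩ := hext h
    rw [e₁] at hf hm
    rw [e₂] at hd
    rw [e₃]
    exact hAv h c hc hf hm d₁ d₂ hd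
  have hlin := hresp.strictLinear_dpref
  obtain ⟨μ, hμacc, hμnone, hμrej⟩ :=
    exists_individually_stable M P (fun h => (hresp.1 h).1) hlin
  have hnotin : ∀ d h, P.dpref d (some h) (μ.assign d) → d ∉ μ.assigned h := by
    intro d h hp hd
    have e : μ.assign d = some h := by simpa [Matching.assigned] using hd
    rw [e] at hp
    exact (hlin d).2.1 _ trivial hp
  have hnone : ∀ d, ¬ P.dpref d none (μ.assign d) := by
    intro d hp
    rcases hμnone d with e | hlt
    · rw [e] at hp
      exact (hlin d).2.1 _ trivial hp
    · exact (hlin d).2.2.2 _ trivial _ trivial hp hlt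
  have hblock : ∀ d k, P.dpref d k (μ.assign d) → ¬ HosPrefers M P μ k {d} := by
    rintro d (_ | h) hp hpref
    · exact hnone d hp
    · obtain ⟨B, hB, -, hcard, hlt⟩ := hpref
      exact (hresp.1 h).not_hpref_singleton (hμacc h) (μ.quota h) (hμrej d h hp)
        (hnotin d h hp) hB hcard hlt
  have hmoved : ∀ d k, P.dpref d k (μ.assign d) → μ.assign d ≠ k := by
    rintro d k hp rfl
    exact (hlin d).2.1 _ trivial hp
  refine ⟨μ, fun k s _ hb => hblock s k hb.1 hb.2, ?_, ?_⟩
  · rintro kf km c hc ⟨hpref, hf, hm, hfm⟩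
    have himp := (hresp.2.1 c hc).exists_improves hpref
    by_cases hk : kf = km
    swap
    · rcases himp with hp | hp
      · exact hblock _ _ hp (hf hk (hmoved _ _ hp))
      · exact hblock _ _ hp (hm hk (hmoved _ _ hp))
    subst hk
    cases kf with
    | none => exact himp.elim (hnone _) (hnone _)
    | some h =>
      obtain ⟨B, hB, hdisj, hcard, hlt⟩ := hfm rfl
      rw [Finset.disjoint_insert_left, Finset.disjoint_singleton_left] at hdisj
      have hne := M.couples_ne c hc
      rcases himp with hp | hp
      · exact (hresp.1 h).not_hpref_pair (hκ h) (hμacc h) (μ.quota h) (hμrej _ h hp)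
          (hnotin _ h hp) hne hB hdisj.2 hcard
          (fun hx hy d₁ d₂ h₁ h₂ h₃ h₄ =>
            hAv' h c hc hx hy d₁ d₂ (Or.inr ⟨h₁, h₂, h₃, h₄⟩)) hlt
      · rw [Finset.pair_comm] at hcard hlt
        refine (hresp.1 h).not_hpref_pair (hκ h) (hμacc h) (μ.quota h) (hμrej _ h hp)
          (hnotin _ h hp) hne.symm hB hdisj.1 hcard
          (fun hx hy d₁ d₂ h₁ h₂ h₃ h₄ => ?_) hlt
        rw [Finset.pair_comm c.2 c.1]
        exact hAv' h c hc hy hx d₁ d₂ (Or.inl ⟨h₁, h₂, h₃, h₄⟩)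
  · rintro h ⟨B, -, -, hcard, hlt⟩
    rw [Finset.union_empty] at hcard hlt
    have hR := hresp.1 h
    rcases hR.weakPref_of_subset Finset.sdiff_subset (hμacc h) (μ.quota h) with e | hgt
    · rw [← e] at hlt
      exact hR.2.1.2.1 _ (μ.quota h) hlt
    · exact hR.2.1.2.2.2 _ hcard _ (μ.quota h) hlt hgt

end CouplesMarket
end

section
/- Consider the market with hospitals H = {h₁,h₂,h₃}, each of capacity 2, and doctors D = {d₁,d₂,d₃,d₄,f,m} where c = {f,m} is the unique couple and d₁,d₂,d₃,d₄ are single. Suppose the preference profile P satisfies: d₁ ranks h₂ first and h₁ second; d₂ ranks h₁ first; d₃ ranks h₂ first; d₄ ranks h₃ first; every hospital finds every doctor acceptable, with individual rankings P̄_{h₁}: d₃, d₄, f, d₁, d₂, m; P̄_{h₂}: d₃, d₄, f, d₁, m, d₂; P̄_{h₃}: d₄, d₃, d₁, f, m, d₂; each hospital's preference over feasible sets is responsive and moreover {f,m} P_{h₁} {d₁,d₂}; the couple's marginal preferences satisfy h₂ P_f h₁, h₂ P_f h₃, h₁ P_m h₃, and h P_f λ, h P_m λ for all h ∈ H; the couple's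 preference P_c is responsive, satisfies (h₁,h₁) P_c (h₂,h₃), and ranks every pair in H × H above every pair containing λ. Then no stable matching exists for P. -/
namespace CouplesMarket

/- Example 1 of the paper: hospitals `h₁ = 0, h₂ = 1, h₃ = 2 : Fin 3`, each of
capacity 2; doctors `d₁ = 0, d₂ = 1, d₃ = 2, d₄ = 3, f = 4, m = 5 : Fin 6`
with the unique couple `c = (f, m) = (4, 5)`. -/
def exampleMarket1 : Market (Fin 6) (Fin 3) where
  κ := fun _ => 2
  couples := {((4 : Fin 6), (5 : Fin 6))}
  couples_ne := by decide
  couples_disjoint := by decide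

/-- Responsiveness iterated: adding a common set of acceptable doctors preserves comparisons. -/
theorem HospResponsive.union_iff {D H : Type} [DecidableEq D] {M : Market D H} {P : Profile D H}
    {h : H} (hP : HospResponsive M P h) {A B : Finset D} (hA : A ⊆ P.acc h) (hB : B ⊆ P.acc h)
    (C : Finset D) (hC : C ⊆ P.acc h) (hAC : Disjoint C A) (hBC : Disjoint C B)
    (cA : C.card + A.card ≤ M.κ h) (cB : C.card + B.card ≤ M.κ h) :
    P.hpref h (C ∪ A) (C ∪ B) ↔ P.hpref h A B := by
  obtain ⟨-, -, -, -, hadd, -⟩ := hP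
  induction C using Finset.induction_on with
  | empty => simp
  | insert x C hx ih =>
    rw [Finset.insert_subset_iff] at hC
    rw [Finset.disjoint_insert_left] at hAC hBC
    rw [Finset.card_insert_of_notMem hx] at cA cB
    rw [Finset.insert_union, Finset.insert_union,
      hadd _ _ (Finset.union_subset hC.2 hA) (Finset.union_subset hC.2 hB) _ _ x hC.1 (by grind)
        (by grind)]
    · exact ih hC.2 hAC.2 hBC.2 (by omega) (by omega)
    · have := Finset.card_union_le C A
      omega
    · have := Finset.card_union_le C B
      omega

section HosPrefers

variable {D H : Type} [Fintype D] [DecidableEq D] [DecidableEq H]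
  {M : Market D H} {P : Profile D H} {μ : Matching M} {h : H} {d : D}

/-- A responsive hospital with a vacancy prefers to add an acceptable doctor. -/
theorem HospResponsive.hosPrefers_of_card_lt (hP : HospResponsive M P h)
    (hμ : μ.assigned h ⊆ P.acc h) (hd : d ∈ P.acc h) (hdh : μ.assign d ≠ some h)
    (hcard : (μ.assigned h).card < M.κ h) : HosPrefers M P μ (some h) {d} := by
  have hdS : d ∉ μ.assigned h := by simpa [Matching.assigned] using hdh
  have key := (hP.union_iff (A := {d}) (B := ∅) (by simpa using hd) (by simp) (μ.assigned h) hμ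
    (by simpa using hdS) (by simp) (by simpa using hcard) (by simpa using hcard.le)).2
    (hP.2.2.1 {d} (by simpa using hd) (by simp) (by simp; omega))
  refine ⟨∅, by simp, by simp, ?_, by simpa using key⟩
  rw [Finset.sdiff_empty, Finset.card_union_of_disjoint (by simpa using hdS)]
  simpa using hcard

/-- A responsive hospital prefers to replace an assigned doctor by a better ranked one. -/
theorem HospResponsive.hosPrefers_of_rank {e : D} (hP : HospResponsive M P h)
    (hμ : μ.assigned h ⊆ P.acc h) (hd : d ∈ P.acc h) (hdh : μ.assign d ≠ some h)
    (heh : μ.assign e = some h) (hde : P.rank h d e) : HosPrefers M P μ (some h) {d} := by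
  have hdS : d ∉ μ.assigned h := by simpa [Matching.assigned] using hdh
  have heS : e ∈ μ.assigned h := by simpa [Matching.assigned] using heh
  have hne : d ≠ e := fun hEq => hdS (hEq ▸ heS)
  have hcard : (μ.assigned h \ {e}).card + 1 ≤ M.κ h := by
    rw [Finset.sdiff_singleton_eq_erase, Finset.card_erase_add_one heS]
    exact μ.quota h
  have hdisj : Disjoint (μ.assigned h \ {e}) {d} := by simp [hdS]
  have key := (hP.union_iff (A := {d}) (B := {e}) (by simpa using hd) (by simpa using hμ heS)
    (μ.assigned h \ {e}) (Finset.sdiff_subset.trans hμ) hdisj Finset.sdiff_disjoint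
    (by simpa using hcard) (by simpa using hcard)).2
    ((hP.2.2.2.1 d hd e (hμ heS) hne).2 hde)
  rw [Finset.sdiff_union_of_subset (by simpa using heS)] at key
  refine ⟨{e}, by simpa using heS, by simpa using hne, ?_, key⟩
  rw [Finset.card_union_of_disjoint hdisj]
  simpa using hcard

/-- A responsive hospital of capacity two that does not want an acceptable doctor is matched with
two doctors, neither of them ranked below that doctor. -/
theorem HospResponsive.exists_pair_of_not_hosPrefers (hP : HospResponsive M P h)
    (hκ : M.κ h = 2) (hμ : μ.assigned h ⊆ P.acc h) (hd : d ∈ P.acc h)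
    (hdh : μ.assign d ≠ some h) (hn : ¬ HosPrefers M P μ (some h) {d}) :
    ∃ i j, i ≠ j ∧ μ.assign i = some h ∧ μ.assign j = some h ∧
      ¬ P.rank h d i ∧ ¬ P.rank h d j := by
  have hlt : 1 < (μ.assigned h).card := by
    by_contra! hle
    exact hn (hP.hosPrefers_of_card_lt hμ hd hdh (by omega))
  obtain ⟨i, hi, j, hj, hij⟩ := Finset.one_lt_card.1 hlt
  simp only [Matching.assigned, Finset.mem_filter, Finset.mem_univ, true_and] at hi hj
  exact ⟨i, j, hij, hi, hj, fun hr => hn (hP.hosPrefers_of_rank hμ hd hdh hi hr),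
    fun hr => hn (hP.hosPrefers_of_rank hμ hd hdh hj hr)⟩

/-- No three distinct doctors share a hospital of capacity two. -/
theorem Matching.not_three (μ : Matching M) (hκ : M.κ h = 2) {i j k : D} (hij : i ≠ j)
    (hik : i ≠ k) (hjk : j ≠ k) (hi : μ.assign i = some h) (hj : μ.assign j = some h) :
    μ.assign k ≠ some h := by
  intro hk
  have hle := μ.quota h
  have hsub : ({i, j, k} : Finset D) ⊆ Finset.univ.filter fun d => μ.assign d = some h := by
    intro x
    simp only [Finset.mem_insert, Finset.mem_singleton, Finset.mem_filter, Finset.mem_univ,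
      true_and]
    rintro (rfl | rfl | rfl) <;> assumption
  have hcard := Finset.card_le_card hsub
  rw [Finset.card_eq_three.2 ⟨i, j, k, hij, hik, hjk, rfl⟩] at hcard
  omega

end HosPrefers

/-- **Example 1**: no stable matching exists for the profile of Table 1. -/
theorem example1_no_stable_matching
    (P : Profile (Fin 6) (Fin 3))
    (hresp : Responsive exampleMarket1 P)
    (hacc : ∀ h : Fin 3, P.acc h = Finset.univ)
    -- `d₁` ranks `h₂` first and `h₁` second
    (hd1a : ∀ x : Option (Fin 3), x ≠ some 1 → P.dpref 0 (some 1) x)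
    (hd1b : ∀ x : Option (Fin 3), x ≠ some 1 → x ≠ some 0 → P.dpref 0 (some 0) x)
    -- `d₂` ranks `h₁` first, `d₃` ranks `h₂` first, `d₄` ranks `h₃` first
    (hd2 : ∀ x : Option (Fin 3), x ≠ some 0 → P.dpref 1 (some 0) x)
    (hd3 : ∀ x : Option (Fin 3), x ≠ some 1 → P.dpref 2 (some 1) x)
    (hd4 : ∀ x : Option (Fin 3), x ≠ some 2 → P.dpref 3 (some 2) x)
    -- `P̄_{h₁} : d₃, d₄, f, d₁, d₂, m`
    (hr1 : P.rank 0 2 3 ∧ P.rank 0 3 4 ∧ P.rank 0 4 0 ∧ P.rank 0 0 1 ∧ P.rank 0 1 5)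
    -- `P̄_{h₂} : d₃, d₄, f, d₁, m, d₂`
    (hr2 : P.rank 1 2 3 ∧ P.rank 1 3 4 ∧ P.rank 1 4 0 ∧ P.rank 1 0 5 ∧ P.rank 1 5 1)
    -- `P̄_{h₃} : d₄, d₃, d₁, f, m, d₂`
    (hr3 : P.rank 2 3 2 ∧ P.rank 2 2 0 ∧ P.rank 2 0 4 ∧ P.rank 2 4 5 ∧ P.rank 2 5 1)
    -- `{f, m} P_{h₁} {d₁, d₂}`
    (hset : P.hpref 0 {4, 5} {0, 1})
    -- couple marginals: `h₂ P_f h₁`, `h₂ P_f h₃`, `h₁ P_m h₃`, and `h P_x λ`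
    (hf1 : P.dpref 4 (some 1) (some 0)) (hf2 : P.dpref 4 (some 1) (some 2))
    (hm1 : P.dpref 5 (some 0) (some 2))
    (hfl : ∀ h : Fin 3, P.dpref 4 (some h) none)
    (hml : ∀ h : Fin 3, P.dpref 5 (some h) none)
    -- `(h₁, h₁) P_c (h₂, h₃)`
    (hc : P.cpref (4, 5) (some 0, some 0) (some 1, some 2))
    -- every pair in `H × H` ranked above every pair containing `λ`
    (hcl : ∀ a b : Fin 3, ∀ p : Option (Fin 3) × Option (Fin 3),
      p.1 = none ∨ p.2 = none → P.cpref (4, 5) (some a, some b) p) :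
    ¬ ∃ μ : Matching exampleMarket1, Stable exampleMarket1 P μ := by
  rintro ⟨μ, hS, hC, -⟩
  obtain ⟨hH, hCpl, -⟩ := hresp
  have hcpl := hCpl (4, 5) (by simp [exampleMarket1])
  replace hC := fun x y => hC x y (4, 5) (by simp [exampleMarket1])
  have cap : ∀ (h : Fin 3) (i j k : Fin 6), i ≠ j → i ≠ k → j ≠ k → μ.assign i = some h →
      μ.assign j = some h → μ.assign k ≠ some h :=
    fun h i j k => μ.not_three rfl
  have pair : ∀ (h : Fin 3) (d : Fin 6), μ.assign d ≠ some h →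
      ¬ HosPrefers exampleMarket1 P μ (some h) {d} →
      ∃ i j, i ≠ j ∧ μ.assign i = some h ∧ μ.assign j = some h ∧
        ¬ P.rank h d i ∧ ¬ P.rank h d j :=
    fun h d => (hH h).exists_pair_of_not_hosPrefers rfl (by simp [hacc]) (by simp [hacc])
  have trans : ∀ h a b c, P.rank h a b → P.rank h b c → P.rank h a c := fun h a b c =>
    (hH h).1.2.2.1 a (by simp [hacc]) b (by simp [hacc]) c (by simp [hacc])
  have unwanted : ∀ (h : Fin 3) (s : Fin 6), s ≠ 4 → s ≠ 5 →
      P.dpref s (some h) (μ.assign s) → ¬ HosPrefers exampleMarket1 P μ (some h) {s} :=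
    fun h s h4 h5 hp hh => hS (some h) s (by simp [Market.Single, exampleMarket1, h4, h5]) ⟨hp, hh⟩
  obtain ⟨r23, r34, r40, r01, r15⟩ := hr1
  obtain ⟨s23, s34, s40, s05, s51⟩ := hr2
  obtain ⟨t32, t20, t04, t45, t51⟩ := hr3
  -- `d₃` and `d₄` obtain their favourite hospitals, where they are ranked first
  have a2 : μ.assign 2 = some 1 := by
    by_contra hne
    obtain ⟨i, j, -, hi, -, hri, -⟩ := pair 1 2 hne (unwanted 1 2 (by decide) (by decide) (hd3 _ hne))
    have q4 := trans _ _ _ _ s23 s34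
    have q0 := trans _ _ _ _ q4 s40
    have q5 := trans _ _ _ _ q0 s05
    have q1 := trans _ _ _ _ q5 s51
    clear * - hne hi hri s23 q4 q0 q5 q1
    fin_cases i <;> simp_all
  have a3 : μ.assign 3 = some 2 := by
    by_contra hne
    obtain ⟨i, j, -, hi, -, hri, -⟩ := pair 2 3 hne (unwanted 2 3 (by decide) (by decide) (hd4 _ hne))
    have q0 := trans _ _ _ _ t32 t20
    have q4 := trans _ _ _ _ q0 t04
    have q5 := trans _ _ _ _ q4 t45
    have q1 := trans _ _ _ _ q5 t51
    clear * - hne hi hri t32 q0 q4 q5 q1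
    fin_cases i <;> simp_all
  have r05 := trans _ _ _ _ r01 r15
  -- `d₁` obtains `h₁` or `h₂`, as `h₁` could be filled with better ranked doctors only by `d₃`, `d₄`, `f`
  have a0 : μ.assign 0 = some 0 ∨ μ.assign 0 = some 1 := by
    by_contra! hne
    obtain ⟨i, j, hij, hi, hj, hri, hrj⟩ :=
      pair 0 0 hne.1 (unwanted 0 0 (by decide) (by decide) (hd1b _ hne.2 hne.1))
    have e : ∀ k, μ.assign k = some 0 → ¬ P.rank 0 0 k → k = 4 := by
      intro k hk hrk
      clear * - hk hrk hne a2 a3 r01 r05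
      fin_cases k <;> simp_all
    exact hij ((e i hi hri).trans (e j hj hrj).symm)
  have a5 : μ.assign 5 ≠ some 1 := by
    intro h5
    have h0 := cap 1 2 5 0 (by decide) (by decide) (by decide) a2 h5
    exact unwanted 1 0 (by decide) (by decide) (hd1a _ h0)
      ((hH 1).hosPrefers_of_rank (by simp [hacc]) (by simp [hacc]) h0 h5 s05)
  have a1 : μ.assign 1 ≠ some 0 → μ.assign 0 = some 0 ∧ μ.assign 4 = some 0 := by
    intro hne
    obtain ⟨i, j, hij, hi, hj, hri, hrj⟩ :=
      pair 0 1 hne (unwanted 0 1 (by decide) (by decide) (hd2 _ hne))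
    have e : ∀ k, μ.assign k = some 0 → ¬ P.rank 0 1 k → k = 0 ∨ k = 4 := by
      intro k hk hrk
      clear * - hk hrk hne a2 a3 r15
      fin_cases k <;> simp_all
    rcases e i hi hri with rfl | rfl <;> rcases e j hj hrj with rfl | rfl
    exacts [absurd rfl hij, ⟨hi, hj⟩, ⟨hj, hi⟩, absurd rfl hij]
  have want_f : μ.assign 4 ≠ some 1 → HosPrefers exampleMarket1 P μ (some 1) {4} := by
    intro hne
    by_contra hn
    obtain ⟨i, j, hij, hi, hj, hri, hrj⟩ := pair 1 4 hne hn
    have q5 := trans _ _ _ _ s40 s05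
    have q1 := trans _ _ _ _ q5 s51
    have e : ∀ k, μ.assign k = some 1 → ¬ P.rank 1 4 k → k = 2 := by
      intro k hk hrk
      clear * - hk hrk hne a3 s40 q5 q1
      fin_cases k <;> simp_all
    exact hij ((e i hi hri).trans (e j hj hrj).symm)
  have want_m : μ.assign 4 ≠ some 2 → μ.assign 5 ≠ some 2 →
      HosPrefers exampleMarket1 P μ (some 2) {5} := by
    intro h4 hne
    by_contra hn
    obtain ⟨i, j, hij, hi, hj, hri, hrj⟩ := pair 2 5 hne hn
    have e : ∀ k, μ.assign k = some 2 → ¬ P.rank 2 5 k → k = 3 := by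
      intro k hk hrk
      clear * - hk hrk h4 hne a0 a2 t51
      fin_cases k
      · rcases a0 with a0 | a0 <;> simp_all
      all_goals simp_all
    exact hij ((e i hi hri).trans (e j hj hrj).symm)
  have want_c : μ.assign 0 = some 0 → μ.assign 1 = some 0 →
      HosPrefers exampleMarket1 P μ (some 0) {4, 5} := by
    intro h0 h1
    have hset' : μ.assigned 0 = {0, 1} := by
      ext k
      simp only [Matching.assigned, Finset.mem_filter, Finset.mem_univ, true_and,
        Finset.mem_insert, Finset.mem_singleton]
      refine ⟨fun hk => ?_, by rintro (rfl | rfl) <;> assumption⟩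
      by_contra! hk'
      exact cap 0 0 1 k (by decide) hk'.1.symm hk'.2.symm h0 h1 hk
    refine ⟨{0, 1}, hset'.ge, by decide, ?_, ?_⟩ <;> rw [hset']
    · decide
    · simpa using hset
  -- the couple blocks with `(h₂, h₃)` or with `(h₁, h₁)` as soon as it prefers that pair
  have block_split : μ.assign 4 ≠ some 2 →
      ¬ P.cpref (4, 5) (some 1, some 2) (μ.assign 4, μ.assign 5) := fun h4 hp =>
    hC (some 1) (some 2) ⟨hp, fun _ => want_f, fun _ => want_m h4, fun h => absurd h (by decide)⟩
  have block_joint : μ.assign 0 = some 0 → μ.assign 1 = some 0 →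
      ¬ P.cpref (4, 5) (some 0, some 0) (μ.assign 4, μ.assign 5) := fun h0 h1 hp =>
    hC (some 0) (some 0) ⟨hp, fun h => absurd rfl h, fun h => absurd rfl h, fun _ => want_c h0 h1⟩
  -- moving `f` alone to `h₂` is a block as soon as `f` prefers it
  have f_stays : ¬ P.dpref 4 (some 1) (μ.assign 4) := fun hp =>
    hC (some 1) (μ.assign 5) ⟨(hcpl.2.2.2 _ _ _).1.2 hp, fun _ => want_f, fun _ h => absurd rfl h,
      fun h => absurd h.symm a5⟩
  have a4 : μ.assign 4 = some 1 := by
    rcases h4 : μ.assign 4 with _ | x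
    · exact absurd (h4 ▸ hfl 1) f_stays
    · fin_cases x
      · exact absurd (h4 ▸ hf1) f_stays
      · rfl
      · exact absurd (h4 ▸ hf2) f_stays
  rcases h5 : μ.assign 5 with _ | x
  · exact block_split (by simp [a4]) (hcl 1 2 _ (Or.inr h5))
  have h0 : μ.assign 0 = some 0 :=
    a0.resolve_right (cap 1 2 4 0 (by decide) (by decide) (by decide) a2 a4)
  have h1 : μ.assign 1 = some 0 := by
    by_contra hne
    exact absurd ((a1 hne).2.symm.trans a4) (by decide)
  fin_cases x
  · exact cap 0 0 1 5 (by decide) (by decide) (by decide) h0 h1 h5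
  · exact a5 h5
  · exact block_joint h0 h1 (by rw [a4, h5]; exact hc)

end CouplesMarket
end
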